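/- Let k be a field, C a coalgebra over k, V a finite-dimensional left C-comodule, and M a left C-comodule. Then there is a k-linear isomorphism Hom_C(V,M) ≅ V* ⊠_C M, where Hom_C denotes comodule homomorphisms and V* = Hom_k(V,k) carries its natural right C-comodule structure dual to the coaction of V. -/

import Mathlib

/-!
For a finite-dimensional left `C`-comodule `V` and a left `C`-comodule `M`,
there is a `k`-linear isomorphism `Hom_C(V,M) ≅ V* ⊠_C M`, where `V*` carries the
right `C`-comodule structure dual to the coaction of `V`.
-/

open TensorProduct

variable (k : Type*) [Field k]

/-- A linear map `ΔM : M → C ⊗ M` is a left `C`-comodule structure on `M` if it is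
coassociative and counital. -/
def IsLeftComodule {C : Type*} [AddCommGroup C] [Module k C] [Coalgebra k C]
    {M : Type*} [AddCommGroup M] [Module k M]
    (ΔM : M →ₗ[k] C ⊗[k] M) : Prop :=
  ((TensorProduct.assoc k C C M).toLinearMap ∘ₗ
      (TensorProduct.map (Coalgebra.comul (R := k) (A := C)) LinearMap.id) ∘ₗ ΔM =
    (TensorProduct.map LinearMap.id ΔM) ∘ₗ ΔM) ∧
  ((TensorProduct.lid k M).toLinearMap ∘ₗ
      (TensorProduct.map (Coalgebra.counit (R := k) (A := C)) LinearMap.id) ∘ₗ ΔM =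
    LinearMap.id)

section CotensorHom

variable {C : Type*} [AddCommGroup C] [Module k C] [Coalgebra k C]

/-- The space `Hom_C(V, M)` of homomorphisms of left `C`-comodules, i.e. linear maps
`f : V → M` with `Δ_M ∘ f = (Id_C ⊗ f) ∘ Δ_V`, as a submodule of `Hom_k(V, M)`. -/
noncomputable def comodHoms {V : Type*} [AddCommGroup V] [Module k V]
    {M : Type*} [AddCommGroup M] [Module k M]
    (ΔV : V →ₗ[k] C ⊗[k] V) (ΔM : M →ₗ[k] C ⊗[k] M) :
    Submodule k (V →ₗ[k] M) :=
  LinearMap.ker ((LinearMap.llcomp k V M (C ⊗[k] M) ΔM) -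
    (LinearMap.lcomp k (C ⊗[k] M) ΔV) ∘ₗ (LinearMap.lTensorHom (R := k) C))

/-- The defining map of the cotensor product `M ⊠_C N` of a right `C`-comodule `(M, ΔM)`
and a left `C`-comodule `(N, ΔN)`:
`Δ_M ⊗ Id_N − Id_M ⊗ Δ_N : M ⊗ N → M ⊗ C ⊗ N` (with the implicit associativity). -/
noncomputable def cotensorMap {M : Type*} [AddCommGroup M] [Module k M]
    {N : Type*} [AddCommGroup N] [Module k N]
    (ΔM : M →ₗ[k] M ⊗[k] C) (ΔN : N →ₗ[k] C ⊗[k] N) :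
    (M ⊗[k] N) →ₗ[k] (M ⊗[k] (C ⊗[k] N)) :=
  (TensorProduct.assoc k M C N).toLinearMap ∘ₗ (TensorProduct.map ΔM LinearMap.id) -
    TensorProduct.map LinearMap.id ΔN

/-- The cotensor product `M ⊠_C N`, the kernel of `Δ_M ⊗ Id_N − Id_M ⊗ Δ_N`. -/
noncomputable def Cotensor {M : Type*} [AddCommGroup M] [Module k M]
    {N : Type*} [AddCommGroup N] [Module k N]
    (ΔM : M →ₗ[k] M ⊗[k] C) (ΔN : N →ₗ[k] C ⊗[k] N) :
    Submodule k (M ⊗[k] N) :=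
  LinearMap.ker (cotensorMap k ΔM ΔN)

omit [Coalgebra k C] in
/-- Contracting the first factor of `x ⊗ m`, for `x ∈ V* ⊗ C`, against `v ∈ V`. -/
theorem dualTensorHom_assoc_tmul_apply
    {V : Type*} [AddCommGroup V] [Module k V] {M : Type*} [AddCommGroup M] [Module k M]
    (x : (V →ₗ[k] k) ⊗[k] C) (m : M) (v : V) :
    dualTensorHom k V (C ⊗[k] M) (TensorProduct.assoc k (V →ₗ[k] k) C M (x ⊗ₜ[k] m)) v =
      (TensorProduct.lid k C
        (TensorProduct.map (LinearMap.applyₗ (R := k) v) (LinearMap.id (R := k) (M := C)) x))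
          ⊗ₜ[k] m := by
  induction x with
  | zero => simp
  | tmul f c => simp [dualTensorHom_apply, TensorProduct.smul_tmul']
  | add x y hx hy => simp only [TensorProduct.add_tmul, map_add, LinearMap.add_apply, hx, hy]

omit [Coalgebra k C] in
/-- Applying `f ⊗ m`, viewed as a map `V → M`, to the second factor of `C ⊗ V`. -/
theorem lTensor_dualTensorHom_tmul_apply
    {V : Type*} [AddCommGroup V] [Module k V] {M : Type*} [AddCommGroup M] [Module k M]
    (f : V →ₗ[k] k) (m : M) (y : C ⊗[k] V) :
    (dualTensorHom k V M (f ⊗ₜ[k] m)).lTensor C y =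
      (TensorProduct.lid k C
        (TensorProduct.map f LinearMap.id (TensorProduct.comm k C V y))) ⊗ₜ[k] m := by
  induction y with
  | zero => simp
  | tmul c w => simp [dualTensorHom_apply, TensorProduct.smul_tmul']
  | add x y hx hy => simp only [TensorProduct.add_tmul, map_add, hx, hy]

omit [Coalgebra k C] in
theorem cotensorMap_tmul {M : Type*} [AddCommGroup M] [Module k M]
    {N : Type*} [AddCommGroup N] [Module k N]
    (ΔM : M →ₗ[k] M ⊗[k] C) (ΔN : N →ₗ[k] C ⊗[k] N) (m : M) (n : N) :
    cotensorMap k ΔM ΔN (m ⊗ₜ[k] n) =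
      TensorProduct.assoc k M C N (ΔM m ⊗ₜ[k] n) - m ⊗ₜ[k] ΔN n :=
  rfl

omit [Coalgebra k C] in
/-- Under `V* ⊗ M → Hom(V, M)`, the map defining `V* ⊠_C M` becomes, up to sign, the map
defining `Hom_C(V, M)`. -/
theorem dualTensorHom_cotensorMap
    {V : Type*} [AddCommGroup V] [Module k V] {M : Type*} [AddCommGroup M] [Module k M]
    (ΔV : V →ₗ[k] C ⊗[k] V) (ΔM : M →ₗ[k] C ⊗[k] M)
    (ΔVdual : (V →ₗ[k] k) →ₗ[k] (V →ₗ[k] k) ⊗[k] C)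
    (hdual : ∀ (f : V →ₗ[k] k) (v : V),
      (TensorProduct.map (LinearMap.applyₗ (R := k) v) (LinearMap.id (R := k) (M := C)))
          (ΔVdual f) =
        (TensorProduct.map f LinearMap.id) ((TensorProduct.comm k C V) (ΔV v)))
    (t : (V →ₗ[k] k) ⊗[k] M) :
    dualTensorHom k V (C ⊗[k] M) (cotensorMap k ΔVdual ΔM t) =
      (dualTensorHom k V M t).lTensor C ∘ₗ ΔV - ΔM ∘ₗ dualTensorHom k V M t := by
  induction t with
  | zero => simp
  | tmul f m =>
    ext v
    rw [cotensorMap_tmul, map_sub, LinearMap.sub_apply, dualTensorHom_assoc_tmul_apply, hdual,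
      LinearMap.sub_apply, LinearMap.comp_apply, LinearMap.comp_apply,
      lTensor_dualTensorHom_tmul_apply, dualTensorHom_apply, dualTensorHom_apply, map_smul]
  | add x y hx hy =>
    simp only [map_add, hx, hy, LinearMap.lTensor_add, LinearMap.add_comp, LinearMap.comp_add]
    abel

/-- let `V` be a finite-dimensional left `C`-comodule and `M` a left
`C`-comodule.  Let `Δ_{V*} : V* → V* ⊗ C` be the right `C`-comodule structure on
`V* = Hom_k(V,k)` dual to the coaction of `V` (characterized by
`(ev_v ⊗ Id)(Δ_{V*} f) = (f ⊗ Id)(τ (Δ_V v))` for all `f, v`).  Then there is a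
`k`-linear isomorphism `Hom_C(V,M) ≅ V* ⊠_C M`. -/
theorem comodHom_iso_cotensor
    {V : Type*} [AddCommGroup V] [Module k V] [FiniteDimensional k V]
    {M : Type*} [AddCommGroup M] [Module k M]
    (ΔV : V →ₗ[k] C ⊗[k] V) (hV : IsLeftComodule k ΔV)
    (ΔM : M →ₗ[k] C ⊗[k] M) (hM : IsLeftComodule k ΔM)
    (ΔVdual : (V →ₗ[k] k) →ₗ[k] (V →ₗ[k] k) ⊗[k] C)
    (hdual : ∀ (f : V →ₗ[k] k) (v : V),
      (TensorProduct.map (LinearMap.applyₗ (R := k) v) (LinearMap.id (R := k) (M := C)))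
          (ΔVdual f) =
        (TensorProduct.map f LinearMap.id) ((TensorProduct.comm k C V) (ΔV v))) :
    Nonempty ((comodHoms k ΔV ΔM) ≃ₗ[k] (Cotensor k ΔVdual ΔM)) := by
  let e := dualTensorHomEquiv k V M
  refine ⟨(e.ofSubmodules (Cotensor k ΔVdual ΔM) (comodHoms k ΔV ΔM) ?_).symm⟩
  rw [Submodule.map_equiv_eq_comap_symm]
  ext g
  obtain ⟨t, rfl⟩ := e.surjective g
  have key := dualTensorHom_cotensorMap k ΔV ΔM ΔVdual hdual t
  have hinj : Function.Injective (dualTensorHom k V (C ⊗[k] M)) :=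
    (dualTensorHomEquiv k V (C ⊗[k] M)).injective
  have he : e t = dualTensorHom k V M t := rfl
  simp only [Submodule.mem_comap, LinearEquiv.coe_coe, LinearEquiv.symm_apply_apply, Cotensor,
    comodHoms, LinearMap.mem_ker]
  rw [← map_eq_zero_iff _ hinj, key, ← he, sub_eq_zero, LinearMap.sub_apply, sub_eq_zero]
  exact eq_comm

end CotensorHom
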